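/- Satisfiability of first-order sentences is reducible to the domino problem in the following effective sense: there is a computable function assigning to each finite nonempty set of tile types T = {t₀, …, tₙ} (encoded as a finite set of quadruples of natural numbers) a sentence φ_T in the first-order language with unary relation symbols P₀, …, Pₙ and binary relation symbols H, V — namely the conjunction of the grid axioms (∀x ∃y H(x,y); ∀x ∃y V(x,y); ∀x ∀y ((∃z (H(x,z) ∧ V(z,y))) ↔ (∃z (V(x,z) ∧ H(z,y))))) with the tiling axioms (every element carries exactly one Pᵢ; H-successors match horizontally; V-successors match vertically) — such that φ_T is satisfiable if and only if there exists a T-tiling of ℕ × ℕ. -/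

import Mathlib

open FirstOrder FirstOrder.Language

/-- The first-order language with countably many unary relation symbols `P₀, P₁, P₂, …`
and two binary relation symbols `H` and `V`. -/
def churchLang : Language :=
  ⟨fun _ => Empty, fun k =>
    match k with
    | 1 => ℕ
    | 2 => Fin 2
    | _ => Empty⟩

instance (k : ℕ) : Encodable (churchLang.Functions k) :=
  inferInstanceAs (Encodable Empty)

instance : ∀ k : ℕ, Encodable (churchLang.Relations k)
  | 0 => inferInstanceAs (Encodable Empty)
  | 1 => inferInstanceAs (Encodable ℕ)
  | 2 => inferInstanceAs (Encodable (Fin 2))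
  | (_ + 3) => inferInstanceAs (Encodable Empty)

instance churchGammaEncodable :
    Encodable (BoundedFormula.encoding (L := churchLang) (α := Empty)).Γ :=
  inferInstanceAs
    (Encodable ((Σ k, churchLang.Term (Empty ⊕ Fin k)) ⊕ ((Σ m, churchLang.Relations m) ⊕ ℕ)))

/-- Sentences of the language are effectively encodable. -/
instance churchSigmaEncodable : Encodable (Σ m, churchLang.BoundedFormula Empty m) :=
  Encodable.ofLeftInjection BoundedFormula.encoding.encode BoundedFormula.encoding.decode
    BoundedFormula.encoding.decode_encode

instance churchSentenceEncodable : Encodable churchLang.Sentence :=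
  Encodable.ofLeftInjection
    (fun φ => (⟨0, φ⟩ : Σ m, churchLang.BoundedFormula Empty m))
    (fun p =>
      match p with
      | ⟨0, φ⟩ => some φ
      | _ => none)
    (fun _ => rfl)


/-- A tile type: a quadruple of colors `(left, right, up, down)`, colors being naturals. -/
abbrev Tile : Type := ℕ × ℕ × ℕ × ℕ

/-- The color of the left edge of a tile type. -/
def Tile.left (t : Tile) : ℕ := t.1
/-- The color of the right edge of a tile type. -/
def Tile.right (t : Tile) : ℕ := t.2.1
/-- The color of the top edge of a tile type. -/
def Tile.up (t : Tile) : ℕ := t.2.2.1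
/-- The color of the bottom edge of a tile type. -/
def Tile.down (t : Tile) : ℕ := t.2.2.2

/-- A `T`-tiling of the full grid `ℕ × ℕ`: horizontally adjacent tiles match
(right color = left color of the right neighbour) and vertically adjacent tiles match
(top color = bottom color of the tile above). -/
def IsPlaneTiling (T : Finset Tile) (f : ℕ × ℕ → {t : Tile // t ∈ T}) : Prop :=
  ∀ i j : ℕ,
    Tile.right (f (i, j)).val = Tile.left (f (i + 1, j)).val ∧
    Tile.up (f (i, j)).val = Tile.down (f (i, j + 1)).val

/-- A sentence is satisfiable iff it is true in some structure with nonempty domain. -/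
def SatSentence (φ : churchLang.Sentence) : Prop :=
  ∃ (M : Type) (S : churchLang.Structure M), Nonempty M ∧
    @FirstOrder.Language.Sentence.Realize churchLang M S φ

/-- The list of symbols encoding a formula, each replaced by its numerical code. -/
def formulaCode {n : ℕ} (φ : churchLang.BoundedFormula Empty n) : List ℕ :=
  φ.listEncode.map fun γ => @Encodable.encode _ churchGammaEncodable γ

theorem Encodable.encode_list_map_encode {α : Type*} [Encodable α] (l : List α) :
    Encodable.encode (l.map Encodable.encode) = Encodable.encode l := by
  induction l with
  | nil => rfl
  | cons a l ih => simp [ih]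

theorem encode_sentence (φ : churchLang.Sentence) :
    Encodable.encode φ = Encodable.encode (formulaCode φ) :=
  (@Encodable.encode_list_map_encode _ churchGammaEncodable φ.listEncode).symm

/-- A family of formulas whose codes depend primitive recursively on the parameter. -/
def PrimrecFormula {α : Type*} [Primcodable α] {n : ℕ}
    (φ : α → churchLang.BoundedFormula Empty n) : Prop :=
  Primrec fun a => formulaCode (φ a)

/-- The atomic formula `Pᵢ(x)`. -/
def atomP {n : ℕ} (i : ℕ) (x : Fin n) : churchLang.BoundedFormula Empty n :=
  Relations.boundedFormula₁ (L := churchLang) (show churchLang.Relations 1 from i)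
    (Term.var (Sum.inr x))

/-- The atomic formula `H(x, y)`. -/
def atomH {n : ℕ} (x y : Fin n) : churchLang.BoundedFormula Empty n :=
  Relations.boundedFormula₂ (L := churchLang) (show churchLang.Relations 2 from (0 : Fin 2))
    (Term.var (Sum.inr x)) (Term.var (Sum.inr y))

/-- The atomic formula `V(x, y)`. -/
def atomV {n : ℕ} (x y : Fin n) : churchLang.BoundedFormula Empty n :=
  Relations.boundedFormula₂ (L := churchLang) (show churchLang.Relations 2 from (1 : Fin 2))
    (Term.var (Sum.inr x)) (Term.var (Sum.inr y))

/-- The conjunction of a finite list of formulas. -/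
def listInf {n : ℕ} (l : List (churchLang.BoundedFormula Empty n)) :
    churchLang.BoundedFormula Empty n :=
  l.foldr (· ⊓ ·) ⊤

/-- The disjunction of a finite list of formulas. -/
def listSup {n : ℕ} (l : List (churchLang.BoundedFormula Empty n)) :
    churchLang.BoundedFormula Empty n :=
  l.foldr (· ⊔ ·) ⊥

namespace PrimrecFormula

variable {α β : Type*} [Primcodable α] [Primcodable β] {n : ℕ}
  {φ ψ : α → churchLang.BoundedFormula Empty n}

theorem const (χ : churchLang.BoundedFormula Empty n) : PrimrecFormula fun _ : α => χ :=
  Primrec.const _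

theorem comp {χ : β → churchLang.BoundedFormula Empty n} (hχ : PrimrecFormula χ) {f : α → β}
    (hf : Primrec f) : PrimrecFormula fun a => χ (f a) :=
  Primrec.comp (f := fun b => formulaCode (χ b)) hχ hf

/-- The operation on codes corresponding to implication. -/
def impCode (c d : List ℕ) : List ℕ :=
  @Encodable.encode _ churchGammaEncodable (Sum.inr (Sum.inr 0)) :: (c ++ d)

theorem formulaCode_imp (φ ψ : churchLang.BoundedFormula Empty n) :
    formulaCode (φ.imp ψ) = impCode (formulaCode φ) (formulaCode ψ) := by
  simp [formulaCode, impCode, BoundedFormula.listEncode]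

theorem primrec_impCode {f g : α → List ℕ} (hf : Primrec f) (hg : Primrec g) :
    Primrec fun a => impCode (f a) (g a) :=
  Primrec.list_cons.comp (Primrec.const _) (Primrec.list_append.comp hf hg)

theorem imp (hφ : PrimrecFormula φ) (hψ : PrimrecFormula ψ) :
    PrimrecFormula fun a => (φ a).imp (ψ a) :=
  (primrec_impCode hφ hψ).of_eq fun a => (formulaCode_imp (φ a) (ψ a)).symm

theorem not (hφ : PrimrecFormula φ) : PrimrecFormula fun a => (φ a).not :=
  hφ.imp (const ⊥)

theorem inf (hφ : PrimrecFormula φ) (hψ : PrimrecFormula ψ) :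
    PrimrecFormula fun a => φ a ⊓ ψ a :=
  (hφ.imp hψ.not).not

theorem all {χ : α → churchLang.BoundedFormula Empty (n + 1)} (hχ : PrimrecFormula χ) :
    PrimrecFormula fun a => (χ a).all :=
  Primrec.list_cons.comp
    (Primrec.const (@Encodable.encode _ churchGammaEncodable (Sum.inr (Sum.inr 1)))) hχ

theorem ite {p : α → Prop} [DecidablePred p] (hp : PrimrecPred p) (hφ : PrimrecFormula φ)
    (hψ : PrimrecFormula ψ) : PrimrecFormula fun a => if p a then φ a else ψ a :=
  (Primrec.ite hp hφ hψ).of_eq fun a => (apply_ite formulaCode (p a) (φ a) (ψ a)).symm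

theorem atomP {f : α → ℕ} (hf : Primrec f) (x : Fin n) :
    PrimrecFormula fun a => _root_.atomP (f a) x := by
  have hcode : Primrec fun a => 2 * (2 * Nat.pair 1 (f a)) + 1 :=
    Primrec.succ.comp <| Primrec.nat_mul.comp (Primrec.const 2) <|
      Primrec.nat_mul.comp (Primrec.const 2) <| Primrec₂.natPair.comp (Primrec.const 1) hf
  exact Primrec.list_cons.comp hcode (Primrec.const
    ([Sum.inr (Sum.inr n), Sum.inl ⟨n, Term.var (Sum.inr x)⟩].map
      fun γ => @Encodable.encode _ churchGammaEncodable γ))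

theorem listInf {l : α → List β} {χ : α → β → churchLang.BoundedFormula Empty n}
    (hl : Primrec l) (hχ : PrimrecFormula fun p : α × β => χ p.1 p.2) :
    PrimrecFormula fun a => listInf ((l a).map (χ a)) := by
  have hc : Primrec fun p : α × β × List ℕ => formulaCode (χ p.1 p.2.1) :=
    hχ.comp (Primrec.fst.pair (Primrec.fst.comp Primrec.snd))
  have hb : Primrec fun _ : α × β × List ℕ =>
      formulaCode (⊥ : churchLang.BoundedFormula Empty n) := Primrec.const _
  have := Primrec.list_foldr (g := fun _ => formulaCode (⊤ : churchLang.BoundedFormula Empty n))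
    hl (Primrec.const _)
    (primrec_impCode (primrec_impCode hc
      (primrec_impCode (Primrec.snd.comp Primrec.snd) hb)) hb).to₂
  refine this.of_eq fun a => ?_
  beta_reduce
  induction l a with
  | nil => rfl
  | cons b l ih =>
    rw [List.foldr_cons, ih]
    simp only [← formulaCode_imp]
    rfl

theorem listSup {l : α → List β} {χ : α → β → churchLang.BoundedFormula Empty n}
    (hl : Primrec l) (hχ : PrimrecFormula fun p : α × β => χ p.1 p.2) :
    PrimrecFormula fun a => listSup ((l a).map (χ a)) := by
  have hc : Primrec fun p : α × β × List ℕ => formulaCode (χ p.1 p.2.1) :=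
    hχ.comp (Primrec.fst.pair (Primrec.fst.comp Primrec.snd))
  have hb : Primrec fun _ : α × β × List ℕ =>
      formulaCode (⊥ : churchLang.BoundedFormula Empty n) := Primrec.const _
  have := Primrec.list_foldr (g := fun _ => formulaCode (⊥ : churchLang.BoundedFormula Empty n))
    hl (Primrec.const _)
    (primrec_impCode (primrec_impCode hc hb) (Primrec.snd.comp Primrec.snd)).to₂
  refine this.of_eq fun a => ?_
  beta_reduce
  induction l a with
  | nil => rfl
  | cons b l ih =>
    rw [List.foldr_cons, ih]
    simp only [← formulaCode_imp]
    rfl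

end PrimrecFormula

/-- The grid axioms: `H` and `V` are serial, and they commute as relations. -/
def gridAxioms : churchLang.Sentence :=
  (∀' ∃' atomH (n := 2) 0 1) ⊓ (∀' ∃' atomV (n := 2) 0 1) ⊓
    ∀' ∀' ((∃' (atomH (n := 3) 0 2 ⊓ atomV 2 1)).iff (∃' (atomV (n := 3) 0 2 ⊓ atomH 2 1)))

/-- Every element carries exactly one of `P₀, …, Pₙ₋₁`. -/
def exactlyOneAxiom (n : ℕ) : churchLang.Sentence :=
  ∀' listSup ((List.range n).map fun i => atomP (n := 1) i 0 ⊓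
    listInf ((List.range n).map fun j => if j = i then ⊤ else (atomP j 0).not))

/-- The tile at position `i` of a list of tile types. -/
def tileAt (l : List Tile) (i : ℕ) : Tile := l.getD i default

/-- `H`-successors match horizontally. -/
def horizontalAxiom (l : List Tile) : churchLang.Sentence :=
  ∀' ∀' (atomH (n := 2) 0 1).imp (listSup ((List.range l.length).map fun i =>
    listSup ((List.range l.length).map fun j =>
      if (tileAt l i).right = (tileAt l j).left then atomP i 0 ⊓ atomP j 1 else ⊥)))

/-- `V`-successors match vertically. -/
def verticalAxiom (l : List Tile) : churchLang.Sentence :=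
  ∀' ∀' (atomV (n := 2) 0 1).imp (listSup ((List.range l.length).map fun i =>
    listSup ((List.range l.length).map fun j =>
      if (tileAt l i).up = (tileAt l j).down then atomP i 0 ⊓ atomP j 1 else ⊥)))

/-- The conjunction of the grid axioms with the tiling axioms of a list of tile types. -/
def tilingSentence (l : List Tile) : churchLang.Sentence :=
  gridAxioms ⊓ (exactlyOneAxiom l.length ⊓ (horizontalAxiom l ⊓ verticalAxiom l))

theorem primrec_tileAt : Primrec₂ tileAt := Primrec.list_getD _

theorem primrecFormula_matching {c d : Tile → ℕ} (hc : Primrec c) (hd : Primrec d) :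
    PrimrecFormula fun l : List Tile => listSup ((List.range l.length).map fun i =>
      listSup ((List.range l.length).map fun j =>
        if c (tileAt l i) = d (tileAt l j) then atomP (n := 2) i 0 ⊓ atomP j 1 else ⊥)) := by
  have hr : Primrec fun l : List Tile => List.range l.length :=
    Primrec.list_range.comp Primrec.list_length
  have hl : Primrec fun p : (List Tile × ℕ) × ℕ => p.1.1 := Primrec.fst.comp Primrec.fst
  have hi : Primrec fun p : (List Tile × ℕ) × ℕ => p.1.2 := Primrec.snd.comp Primrec.fst
  refine .listSup hr (.listSup (hr.comp Primrec.fst) (.ite ?_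
    (.inf (.atomP hi 0) (.atomP Primrec.snd 1)) (.const ⊥)))
  exact Primrec.eq.comp (hc.comp (primrec_tileAt.comp hl hi))
    (hd.comp (primrec_tileAt.comp hl Primrec.snd))

theorem primrecFormula_exactlyOneAxiom : PrimrecFormula exactlyOneAxiom := by
  refine .all (.listSup Primrec.list_range (.inf (.atomP Primrec.snd 0)
    (.listInf (Primrec.list_range.comp Primrec.fst) (.ite ?_ (.const ⊤)
      (.not (.atomP Primrec.snd 0))))))
  exact Primrec.eq.comp Primrec.snd (Primrec.snd.comp Primrec.fst)

theorem primrecFormula_tilingSentence : PrimrecFormula tilingSentence := by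
  have hright : Primrec Tile.right := Primrec.fst.comp Primrec.snd
  have hup : Primrec Tile.up := Primrec.fst.comp (Primrec.snd.comp Primrec.snd)
  have hdown : Primrec Tile.down := Primrec.snd.comp (Primrec.snd.comp Primrec.snd)
  exact .inf (.const _) (.inf (primrecFormula_exactlyOneAxiom.comp Primrec.list_length)
    (.inf (.all (.all (.imp (.const _) (primrecFormula_matching hright Primrec.fst))))
      (.all (.all (.imp (.const _) (primrecFormula_matching hup hdown))))))

/-- The elements of a finite set of tile types, listed in increasing order of their codes. -/
def tileList (T : Finset Tile) : List Tile :=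
  ((T.map (Denumerable.eqv Tile).toEmbedding).sort).map (Denumerable.ofNat Tile)

theorem mem_tileList {T : Finset Tile} {t : Tile} : t ∈ tileList T ↔ t ∈ T := by
  simp only [tileList, List.mem_map, Finset.mem_sort, Finset.mem_map, Equiv.coe_toEmbedding]
  constructor
  · rintro ⟨_, ⟨s, hs, rfl⟩, rfl⟩
    rwa [Denumerable.eqv, Equiv.coe_fn_mk, Denumerable.ofNat_encode]
  · exact fun ht => ⟨_, ⟨t, ht, rfl⟩, Denumerable.ofNat_encode t⟩

theorem raise'_eq_foldl (l acc : List ℕ) (n : ℕ) :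
    (l.foldl (fun s m => (s.1 ++ [m + s.2], m + s.2 + 1)) (acc, n)).1 =
      acc ++ Denumerable.raise' l n := by
  induction l generalizing acc n with
  | nil => simp [Denumerable.raise']
  | cons m l ih => simp [Denumerable.raise', ih]

theorem primrec_raise' (n : ℕ) : Primrec fun l => Denumerable.raise' l n := by
  have hm : Primrec fun p : List ℕ × (List ℕ × ℕ) × ℕ => p.2.2 + p.2.1.2 :=
    Primrec.nat_add.comp (Primrec.snd.comp Primrec.snd)
      (Primrec.snd.comp (Primrec.fst.comp Primrec.snd))
  have hacc : Primrec fun p : List ℕ × (List ℕ × ℕ) × ℕ => p.2.1.1 :=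
    Primrec.fst.comp (Primrec.fst.comp Primrec.snd)
  have := Primrec.list_foldl (f := fun l : List ℕ => l) (g := fun _ => (([] : List ℕ), n))
    Primrec.id (Primrec.const _)
    ((Primrec.list_concat.comp hacc hm).pair (Primrec.succ.comp hm)).to₂
  exact (Primrec.fst.comp this).of_eq fun l => raise'_eq_foldl l [] n

theorem primrec_tile_ofNat : Primrec (Denumerable.ofNat Tile) := by
  have h₁ : Primrec fun n : ℕ => n.unpair.1 := Primrec.fst.comp Primrec.unpair
  have h₂ : Primrec fun n : ℕ => n.unpair.2 := Primrec.snd.comp Primrec.unpair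
  exact (h₁.pair ((h₁.comp h₂).pair ((h₁.comp (h₂.comp h₂)).pair (h₂.comp (h₂.comp h₂))))).of_eq
    fun n => by simp

theorem tileList_eq (T : Finset Tile) :
    tileList T = (Denumerable.raise' ((Encodable.decode (α := List ℕ)
      (@Encodable.encode _ Primcodable.toEncodable T)).getD []) 0).map (Denumerable.ofNat Tile) := by
  have h : @Encodable.encode _ Primcodable.toEncodable T = Encodable.encode (Denumerable.lower'
      ((T.map (Denumerable.eqv Tile).toEmbedding).sort) 0) := rfl
  rw [h, Encodable.encodek, Option.getD_some,
    Denumerable.raise_lower' (fun _ _ => Nat.zero_le _) (Finset.sortedLT_sort _), tileList]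

theorem primrec_tileList : Primrec tileList :=
  (Primrec.list_map ((primrec_raise' 0).comp (Primrec.option_getD.comp
    (Primrec.decode.comp Primrec.encode) (Primrec.const [])))
    (primrec_tile_ofNat.comp Primrec.snd).to₂).of_eq fun T => (tileList_eq T).symm

theorem realize_tilingSentence {M : Type} [churchLang.Structure M] (l : List Tile)
    {H V : M → M → Prop} {P : ℕ → M → Prop}
    (hH : ∀ x y, Structure.RelMap (L := churchLang) (n := 2) (0 : Fin 2) ![x, y] ↔ H x y)
    (hV : ∀ x y, Structure.RelMap (L := churchLang) (n := 2) (1 : Fin 2) ![x, y] ↔ V x y)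
    (hP : ∀ (i : ℕ) x, Structure.RelMap (L := churchLang) (n := 1) i ![x] ↔ P i x) :
    M ⊨ tilingSentence l ↔
      ((∀ x, ∃ y, H x y) ∧ (∀ x, ∃ y, V x y) ∧
        ∀ x y, (∃ z, H x z ∧ V z y) ↔ ∃ z, V x z ∧ H z y) ∧
      (∀ x, ∃ i < l.length, P i x ∧ ∀ j < l.length, P j x → j = i) ∧
      (∀ x y, H x y → ∃ i < l.length, ∃ j < l.length,
        (tileAt l i).right = (tileAt l j).left ∧ P i x ∧ P j y) ∧
      ∀ x y, V x y → ∃ i < l.length, ∃ j < l.length,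
        (tileAt l i).up = (tileAt l j).down ∧ P i x ∧ P j y := by
  have realize_ite (n : ℕ) (p : Prop) [Decidable p] (φ ψ : churchLang.BoundedFormula Empty n)
      (v : Empty → M) (xs : Fin n → M) : (if p then φ else ψ).Realize v xs ↔
        if p then φ.Realize v xs else ψ.Realize v xs := by split_ifs <;> rfl
  have realizeH {n : ℕ} (x y : Fin n) (v : Empty → M) (xs : Fin n → M) :
      (atomH x y).Realize v xs ↔ H (xs x) (xs y) :=
    BoundedFormula.realize_rel₂.trans (hH _ _)
  have realizeV {n : ℕ} (x y : Fin n) (v : Empty → M) (xs : Fin n → M) :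
      (atomV x y).Realize v xs ↔ V (xs x) (xs y) :=
    BoundedFormula.realize_rel₂.trans (hV _ _)
  have realizeP {n : ℕ} (i : ℕ) (x : Fin n) (v : Empty → M) (xs : Fin n → M) :
      (atomP i x).Realize v xs ↔ P i (xs x) :=
    BoundedFormula.realize_rel₁.trans (hP _ _)
  simp [tilingSentence, gridAxioms, exactlyOneAxiom, horizontalAxiom, verticalAxiom,
    Sentence.Realize, Formula.Realize, realizeH, realizeV, realizeP, realize_ite,
    listSup, listInf, BoundedFormula.realize_foldr_sup, BoundedFormula.realize_foldr_inf, Fin.snoc,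
    and_assoc, not_imp_not]

/-- If `S` followed by `R` can always be replaced by `R` followed by `S`, then a staircase of
alternating `R`- and `S`-steps extends to all the diagonals on one side of it. -/
theorem exists_diagonals {M : Type*} {R S : M → M → Prop}
    (hcomm : ∀ x y z, S x y → R y z → ∃ w, R x w ∧ S w z) {a b : ℕ → M}
    (hab : ∀ k, R (a k) (b k)) (hba : ∀ k, S (b k) (a (k + 1))) :
    ∃ A : ℕ → ℕ → M, A 0 = a ∧
      ∀ d k, R (A d k) (A (d + 1) k) ∧ S (A (d + 1) k) (A d (k + 1)) := by
  let Stair := {p : (ℕ → M) × (ℕ → M) // ∀ k, R (p.1 k) (p.2 k) ∧ S (p.2 k) (p.1 (k + 1))}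
  have step (p : Stair) : ∃ q : Stair, q.1.1 = p.1.2 := by
    choose c hc using fun k => hcomm _ _ _ (p.2 k).2 (p.2 (k + 1)).1
    exact ⟨⟨(p.1.2, c), hc⟩, rfl⟩
  choose next hnext using step
  let s (d : ℕ) : Stair := next^[d] ⟨(a, b), fun k => ⟨hab k, hba k⟩⟩
  have hs (d : ℕ) : (s (d + 1)).1.1 = (s d).1.2 := by
    simp only [s, Function.iterate_succ_apply', hnext]
  refine ⟨fun d => (s d).1.1, rfl, fun d k => ?_⟩
  simpa only [hs] using (s d).2 k

/-- Serial commuting relations `H`, `V` admit a homomorphism from the grid `ℕ × ℕ`. -/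
theorem exists_grid {M : Type*} [Nonempty M] {H V : M → M → Prop} (hH : ∀ x, ∃ y, H x y)
    (hV : ∀ x, ∃ y, V x y) (hHV : ∀ x y, (∃ z, H x z ∧ V z y) ↔ ∃ z, V x z ∧ H z y) :
    ∃ g : ℕ × ℕ → M, ∀ i j, H (g (i, j)) (g (i + 1, j)) ∧ V (g (i, j)) (g (i, j + 1)) := by
  choose h hh using hH
  choose v hv using hV
  have hcomm x y z (hxy : H x y) (hyz : V y z) : ∃ w, V x w ∧ H w z := (hHV x z).1 ⟨y, hxy, hyz⟩
  let a (k : ℕ) : M := (v ∘ h)^[k] (Classical.arbitrary M)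
  have ha (k : ℕ) : a (k + 1) = v (h (a k)) := Function.iterate_succ_apply' ..
  choose c hc using fun k => hcomm (a k) (h (a k)) (a (k + 1)) (hh _) (ha k ▸ hv _)
  obtain ⟨A, hA₀, hA⟩ := exists_diagonals (R := H) (S := V) (a := a) (b := fun k => h (a k))
    (fun x y z hxy hyz => (hHV x z).2 ⟨y, hxy, hyz⟩) (fun k => hh _) (fun k => ha k ▸ hv _)
  obtain ⟨B, hB₀, hB⟩ := exists_diagonals hcomm (fun k => (hc k).1) (fun k => (hc k).2)
  let g (p : ℕ × ℕ) : M := if p.2 ≤ p.1 then A (p.1 - p.2) p.2 else B (p.2 - p.1) p.1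
  have hgA (d k : ℕ) : g (k + d, k) = A d k := by simp [g]
  have hgB (d k : ℕ) : g (k, k + d) = B d k := by
    cases d with
    | zero => simp [g, hA₀, hB₀]
    | succ d => simp [g]
  refine ⟨g, fun i j => ⟨?_, ?_⟩⟩
  · rcases le_or_gt j i with hij | hij
    · obtain ⟨d, rfl⟩ := Nat.exists_eq_add_of_le hij
      simpa only [hgA, Nat.add_assoc] using (hA d j).1
    · obtain ⟨d, rfl⟩ := Nat.exists_eq_add_of_le (Nat.succ_le_of_lt hij)
      simpa only [← hgB, Nat.succ_eq_add_one, Nat.add_right_comm, ← Nat.add_assoc] using (hB d i).2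
  · rcases le_or_gt i j with hij | hij
    · obtain ⟨d, rfl⟩ := Nat.exists_eq_add_of_le hij
      simpa only [hgB, Nat.add_assoc] using (hB d i).1
    · obtain ⟨d, rfl⟩ := Nat.exists_eq_add_of_le (Nat.succ_le_of_lt hij)
      simpa only [← hgA, Nat.succ_eq_add_one, Nat.add_right_comm, ← Nat.add_assoc] using (hA d j).2

theorem satisfiable_tilingSentence_iff (T : Finset Tile) :
    SatSentence (tilingSentence (tileList T)) ↔
      ∃ f : ℕ × ℕ → {t : Tile // t ∈ T}, IsPlaneTiling T f := by
  constructor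
  · rintro ⟨M, S, hM, hS⟩
    rw [realize_tilingSentence _ (fun _ _ => Iff.rfl) (fun _ _ => Iff.rfl)
      (fun _ _ => Iff.rfl)] at hS
    obtain ⟨⟨hH, hV, hHV⟩, hP, hhor, hver⟩ := hS
    obtain ⟨g, hg⟩ := exists_grid hH hV hHV
    choose idx hidx _ huniq using hP
    have hmem (x : M) : tileAt (tileList T) (idx x) ∈ T := by
      rw [← mem_tileList, tileAt, List.getD_eq_getElem _ _ (hidx x)]
      exact List.getElem_mem _
    refine ⟨fun p => ⟨_, hmem (g p)⟩, fun i j => ⟨?_, ?_⟩⟩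
    · obtain ⟨k, hk, m, hm, hkm, hPk, hPm⟩ := hhor _ _ (hg i j).1
      rwa [huniq _ k hk hPk, huniq _ m hm hPm] at hkm
    · obtain ⟨k, hk, m, hm, hkm, hPk, hPm⟩ := hver _ _ (hg i j).2
      rwa [huniq _ k hk hPk, huniq _ m hm hPm] at hkm
  · rintro ⟨f, hf⟩
    let idx (p : ℕ × ℕ) : ℕ := (tileList T).idxOf (f p).1
    have hidx (p) : idx p < (tileList T).length :=
      List.idxOf_lt_length_of_mem (mem_tileList.2 (f p).2)
    have htile (p) : tileAt (tileList T) (idx p) = (f p).1 := by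
      rw [tileAt, List.getD_eq_getElem _ _ (hidx p), List.getElem_idxOf]
    let S : churchLang.Structure (ℕ × ℕ) :=
      { funMap := fun F => nomatch F
        RelMap := fun {k} R x => match k, R, x with
          | 1, R, x => R = idx (x 0)
          | 2, (R : Fin 2), x => x 1 = if R.1 = 0 then ((x 0).1 + 1, (x 0).2)
              else ((x 0).1, (x 0).2 + 1) }
    refine ⟨ℕ × ℕ, S, inferInstance, ?_⟩
    rw [realize_tilingSentence (H := fun x y => y = (x.1 + 1, x.2))
      (V := fun x y => y = (x.1, x.2 + 1)) (P := fun i x => i = idx x) _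
      (fun _ _ => Iff.rfl) (fun _ _ => Iff.rfl) (fun _ _ => Iff.rfl)]
    refine ⟨⟨by simp, by simp, by simp⟩, fun x => ⟨idx x, hidx x, rfl, by simp⟩, ?_, ?_⟩
    · rintro ⟨i, j⟩ _ rfl
      exact ⟨_, hidx _, _, hidx _, by simpa only [htile] using (hf i j).1, rfl, rfl⟩
    · rintro ⟨i, j⟩ _ rfl
      exact ⟨_, hidx _, _, hidx _, by simpa only [htile] using (hf i j).2, rfl, rfl⟩

/-- Satisfiability effectively reduces the domino problem: there is a computable map
sending each finite nonempty set `T = {t₀, …, tₙ}` of tile types to a sentence `φ_T`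
(the conjunction of the grid axioms with the tiling axioms for `T`) in the language with
unary predicate symbols `P₀, P₁, …` and binary predicate symbols `H, V`, such that `φ_T`
is satisfiable iff there is a `T`-tiling of `ℕ × ℕ`. -/
theorem satisfiability_reduction_of_domino :
    ∃ φ : Finset Tile → churchLang.Sentence,
      Computable (fun T : Finset Tile => Encodable.encode (φ T)) ∧
      ∀ T : Finset Tile, T.Nonempty →
        (SatSentence (φ T) ↔ ∃ f : ℕ × ℕ → {t : Tile // t ∈ T}, IsPlaneTiling T f) := by
  refine ⟨fun T => tilingSentence (tileList T), ?_, fun T _ => satisfiable_tilingSentence_iff T⟩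
  have h : Primrec fun T => formulaCode (tilingSentence (tileList T)) :=
    primrecFormula_tilingSentence.comp primrec_tileList
  exact ((Primrec.encode.comp h).of_eq fun T => (encode_sentence _).symm).to_comp
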